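/- Let f_1,…,f_m ∈ ℝ[x_1,…,x_n], let d be an even positive integer with d ≥ deg f_i for all i, let T be the Chebyshev polynomial of the first kind of degree d, let q_1 < … < q_m be the m smallest primes greater than n, and define g_i^+(x) = n + 1/q_i + ∑_{k=1}^{n} T(x_k)/(q_i − n − 1 + k), g_i^− = −g_i^+. Let σ ∈ {≤, =, ≥}^m, and for S = {i_1,…,i_s} ⊆ {1,…,m} let 𝒯_S = {τ ∈ {+,−}^s : τ_j = '+' if σ_{i_j} is '≥' and τ_j = '−' if σ_{i_j} is '≤'}. Then there exists a nonzero polynomial q, with real coefficients, in the n² entries of an n×n matrix, such that every V ∈ ℚ^{n×n} with q(V) ≠ 0 is invertible and has the following property. Write f̃_i(x) = f_i(Vx) and F̃_i^±(t,x) = (1−t) f̃_i(x) + t g_i^±(x). For every connected component C of {x ∈ ℝⁿ : f̃_1(x) σ_1 0, …, f̃_m(x) σ_m 0}, every z ∈ Z(C), and every ε > 0, there exist a nonempty subset S = {i_1,…,i_s} ⊆ {1,…,m} with s ≤ n, τ ∈ 𝒯_S, a real number t with 0 < t < ε, and w ∈ ℝⁿ with ‖w − z‖ < ε, such that F̃_{i_j}^{τ_j}(t,w)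 = 0 for all j = 1,…,s and, if s ≤ n−1, the vectors ((∂F̃_{i_j}^{τ_j}/∂x_k)(t,w))_{k=2,…,n} ∈ ℝ^{n−1}, j = 1,…,s, are linearly dependent over ℝ. -/

import Mathlib

open MvPolynomial Set

/-- A closed sign symbol among `≤, =, ≥`. -/
inductive Sign3c | le | eq | ge
deriving DecidableEq

/-- The relation "`t σ 0`" for a closed sign symbol `σ`. -/
def Sign3c.holds : Sign3c → ℝ → Prop
  | .le, t => t ≤ 0
  | .eq, t => t = 0
  | .ge, t => 0 ≤ t

/-- The projection `π_1` of a subset of `ℝⁿ` to its first coordinate. -/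
def proj1 {n : ℕ} (hn : 0 < n) (A : Set (EuclideanSpace ℝ (Fin n))) : Set ℝ :=
  (fun x => x ⟨0, hn⟩) '' A

/-- `Z_inf(A)` with respect to the first coordinate. -/
def Zinf {n : ℕ} (hn : 0 < n) (A : Set (EuclideanSpace ℝ (Fin n))) :
    Set (EuclideanSpace ℝ (Fin n)) :=
  {x | x ∈ closure A ∧ BddBelow (proj1 hn A) ∧ x ⟨0, hn⟩ = sInf (proj1 hn A)}

/-- `Z_sup(A)` with respect to the first coordinate. -/
def Zsup {n : ℕ} (hn : 0 < n) (A : Set (EuclideanSpace ℝ (Fin n))) :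
    Set (EuclideanSpace ℝ (Fin n)) :=
  {x | x ∈ closure A ∧ BddAbove (proj1 hn A) ∧ x ⟨0, hn⟩ = sSup (proj1 hn A)}

/-- `Z(A) = Z_inf(A) ∪ Z_sup(A)`. -/
def ZZ {n : ℕ} (hn : 0 < n) (A : Set (EuclideanSpace ℝ (Fin n))) :
    Set (EuclideanSpace ℝ (Fin n)) :=
  Zinf hn A ∪ Zsup hn A

/-- `g_i^+` as a real polynomial:
`n + 1/q_i + ∑_{k=1}^n T(x_k)/(q_i - n - 1 + k)`, `T` the Chebyshev polynomial
of the first kind of degree `d`. -/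
noncomputable def gpPoly (n d qi : ℕ) : MvPolynomial (Fin n) ℝ :=
  C (n : ℝ) + C (((qi : ℕ) : ℝ))⁻¹ +
    ∑ k : Fin n, C (((qi - n - 1 + ((k : ℕ) + 1) : ℕ) : ℝ))⁻¹ *
      Polynomial.aeval (X k) (Polynomial.Chebyshev.T ℝ d)

/-- The polynomial `x ↦ p(Vx)`. -/
noncomputable def compMat {n : ℕ} (V : Matrix (Fin n) (Fin n) ℚ)
    (p : MvPolynomial (Fin n) ℝ) : MvPolynomial (Fin n) ℝ :=
  aeval (fun j : Fin n => ∑ k : Fin n, C ((V j k : ℚ) : ℝ) * X k) p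

/-- The deformed polynomial `F̃_i^±(t,·) = (1-t) f_i(V·) + t g_i^±`, with sign `+`
when `b = true`. -/
noncomputable def Fdef {n : ℕ} (d qi : ℕ) (V : Matrix (Fin n) (Fin n) ℚ)
    (p : MvPolynomial (Fin n) ℝ) (b : Bool) (t : ℝ) : MvPolynomial (Fin n) ℝ :=
  C (1 - t) * compMat V p + C t * (if b then gpPoly n d qi else -gpPoly n d qi)

theorem exists_derivation_of_isTranscendenceBasis {k K ι : Type} [Field k] [CharZero k] [Field K]
    [Algebra k K] [DecidableEq ι] {x : ι → K} (hx : IsTranscendenceBasis k x) (i : ι) :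
    ∃ D : Derivation k K K, ∀ j, D (x j) = if j = i then 1 else 0 := by
  let _ : Algebra (MvPolynomial ι k) K := (aeval x : MvPolynomial ι k →ₐ[k] K).toAlgebra
  have : IsScalarTower k (MvPolynomial ι k) K := IsScalarTower.of_algHom (aeval x)
  have hinj : Function.Injective (algebraMap (MvPolynomial ι k) K) := hx.1
  have : FaithfulSMul (MvPolynomial ι k) K := (faithfulSMul_iff_algebraMap_injective _ _).2 hinj
  let _ : Algebra (FractionRing (MvPolynomial ι k)) K := FractionRing.liftAlgebra _ K
  have halg : Algebra.IsAlgebraic (MvPolynomial ι k) K := by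
    have := hx.isAlgebraic
    refine Algebra.IsAlgebraic.ringHom_of_comp_eq (R := Algebra.adjoin k (range x)) (A := K)
      (hx.1.aevalEquiv.symm : _ ≃ₐ[k] _) (RingHom.id K) (AlgEquiv.injective _)
      Function.surjective_id ?_
    ext a
    exact AlgebraicIndependent.aeval_repr hx.1 a
  have : Algebra.IsAlgebraic (FractionRing (MvPolynomial ι k)) K :=
    (IsFractionRing.comap_isAlgebraic_iff (A := MvPolynomial ι k)).1 halg
  have : CharZero (FractionRing (MvPolynomial ι k)) :=
    charZero_of_injective_algebraMap (IsFractionRing.injective (MvPolynomial ι k) _)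
  have : Algebra.FormallyEtale (MvPolynomial ι k) (FractionRing (MvPolynomial ι k)) :=
    Algebra.FormallyEtale.of_isLocalization (nonZeroDivisors (MvPolynomial ι k))
  have : Algebra.FormallyEtale (FractionRing (MvPolynomial ι k)) K :=
    Algebra.FormallyEtale.of_isSeparable _ _
  have : Algebra.FormallyEtale (MvPolynomial ι k) K :=
    Algebra.FormallyEtale.comp _ (FractionRing (MvPolynomial ι k)) _
  let d : Derivation k (MvPolynomial ι k) K := mkDerivation k (fun j => if j = i then 1 else 0)
  let e := KaehlerDifferential.tensorKaehlerEquivOfFormallyEtale k (MvPolynomial ι k) K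
  let φ : Ω[K⁄k] →ₗ[K] K := (d.liftKaehlerDifferential.liftBaseChange K) ∘ₗ e.symm.toLinearMap
  refine ⟨φ.compDer (KaehlerDifferential.D k K), fun j => ?_⟩
  have h1 : x j = algebraMap (MvPolynomial ι k) K (X j) := (aeval_X x j).symm
  rw [h1]
  have := KaehlerDifferential.tensorKaehlerEquivOfFormallyEtale_symm_D_algebraMap
    k (MvPolynomial ι k) K (X j)
  simp [φ, e, this, d, mkDerivation_X]

theorem exists_isTranscendenceBasis_quotient {k : Type} [Field k] {n : ℕ}
    (P : Ideal (MvPolynomial (Fin n) k)) [P.IsPrime] :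
    ∃ I : Set (Fin n), IsTranscendenceBasis k
      (fun i : I => (Ideal.Quotient.mk P (X (i : Fin n)) : MvPolynomial (Fin n) k ⧸ P)) := by
  let x : Fin n → MvPolynomial (Fin n) k ⧸ P := fun i => Ideal.Quotient.mk P (X i)
  have htop : Algebra.adjoin k (range x) = ⊤ := by
    have h := AlgHom.map_adjoin (Ideal.Quotient.mkₐ k P) (range X)
    rw [adjoin_range_X, Algebra.map_top, (AlgHom.range_eq_top _).2
      (Ideal.Quotient.mkₐ_surjective k P), ← range_comp] at h
    exact h.symm
  have : Algebra.IsAlgebraic (Algebra.adjoin k (range x)) (MvPolynomial (Fin n) k ⧸ P) :=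
    ⟨fun a => isAlgebraic_algebraMap (⟨a, htop ▸ Algebra.mem_top⟩ : Algebra.adjoin k (range x))⟩
  obtain ⟨t, ht, hbasis⟩ := exists_isTranscendenceBasis_subset (R := k) (range x)
  obtain ⟨I, -, hI⟩ := surjOn_iff_exists_bijOn_subset.1
    (show SurjOn x univ t by rwa [SurjOn, image_univ])
  refine ⟨I, (isTranscendenceBasis_image hI.injOn).2 ?_⟩
  rw [hI.image_eq]
  exact hbasis

/-- Vector fields tangent to an irreducible variety, spanning its tangent space generically. -/
theorem exists_tangent_vectorFields {k : Type} [Field k] [CharZero k] {n : ℕ}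
    (P : Ideal (MvPolynomial (Fin n) k)) [P.IsPrime] :
    ∃ (I : Set (Fin n)) (s : MvPolynomial (Fin n) k) (a : I → Fin n → MvPolynomial (Fin n) k),
      Algebra.trdeg k (MvPolynomial (Fin n) k ⧸ P) = Cardinal.mk I ∧ s ∉ P ∧
      (∀ i, ∀ h ∈ P, ∑ j, a i j * pderiv j h ∈ P) ∧
      (∀ i, a i i - s ∈ P) ∧ ∀ i k : I, k ≠ i → a i k ∈ P := by
  classical
  obtain ⟨I, hI⟩ := exists_isTranscendenceBasis_quotient P
  let A := MvPolynomial (Fin n) k ⧸ P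
  let K := FractionRing A
  have : Algebra.IsAlgebraic A K := IsLocalization.isAlgebraic K (nonZeroDivisors A)
  have hIK := hI.algebraMap_comp (A := K)
  choose D hD using fun i => exists_derivation_of_isTranscendenceBasis hIK i
  let x : Fin n → K := fun j => algebraMap A K (Ideal.Quotient.mk P (X j))
  obtain ⟨b, hb⟩ := IsLocalization.exist_integer_multiples_of_finite (nonZeroDivisors A)
    (fun ij : I × Fin n => D ij.1 (x ij.2))
  choose c hc using hb
  obtain ⟨s, hs⟩ := Ideal.Quotient.mk_surjective (b : A)
  choose a ha using fun (i : I) (j : Fin n) => Ideal.Quotient.mk_surjective (c (i, j))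
  have hinj : Function.Injective (algebraMap A K) := IsFractionRing.injective A K
  have hbc : ∀ i j, algebraMap A K (Ideal.Quotient.mk P (a i j))
      = algebraMap A K (Ideal.Quotient.mk P s) * D i (x j) := by
    intro i j
    rw [ha, hc, hs, Algebra.smul_def]
  refine ⟨I, s, a, hI.cardinalMk_eq_trdeg.symm, ?_, ?_, ?_, ?_⟩
  · intro h
    rw [Ideal.Quotient.eq_zero_iff_mem.2 h] at hs
    exact nonZeroDivisors.coe_ne_zero b hs.symm
  · intro i h hh
    have key : ∀ h : MvPolynomial (Fin n) k,
        algebraMap A K (Ideal.Quotient.mk P (∑ j, a i j * pderiv j h)) =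
        algebraMap A K (Ideal.Quotient.mk P s) * D i (algebraMap A K (Ideal.Quotient.mk P h)) := by
      intro h
      induction h using MvPolynomial.induction_on with
      | C r =>
        have e : algebraMap A K (Ideal.Quotient.mk P (C r)) = algebraMap k K r := rfl
        simp [e]
      | add p q hp hq =>
        simp only [map_add, mul_add, Finset.sum_add_distrib] at hp hq ⊢
        rw [hp, hq]
      | mul_X p l hp =>
        have e : ∑ j, a i j * pderiv j (p * X l) = X l * (∑ j, a i j * pderiv j p) + p * a i l := by
          simp only [Derivation.leibniz, pderiv_X, smul_eq_mul, mul_add, Finset.sum_add_distrib,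
            Finset.mul_sum, Pi.single_apply, mul_ite, mul_one, mul_zero]
          rw [add_comm, mul_comm]
          congr 1
          · exact Finset.sum_congr rfl fun j _ => by ring
          · simp [mul_comm]
        rw [e]
        simp only [map_add, map_mul, Derivation.leibniz, smul_eq_mul] at hp ⊢
        rw [hp, hbc]
        ring
    have := key h
    rw [Ideal.Quotient.eq_zero_iff_mem.2 hh, map_zero, map_zero, mul_zero] at this
    exact Ideal.Quotient.eq_zero_iff_mem.1 (hinj (this.trans (map_zero _).symm))
  · intro i
    rw [← Ideal.Quotient.eq]
    apply hinj
    have := hD i i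
    rw [if_pos rfl] at this
    rw [hbc, show D i (x i) = 1 from this, mul_one]
  · intro i k hk
    rw [← Ideal.Quotient.eq_zero_iff_mem]
    apply hinj
    have := hD i k
    rw [if_neg hk] at this
    rw [hbc, show D i (x k) = 0 from this, mul_zero, map_zero]

/-- Covectors annihilating a generic tangent space, together with one coordinate of the
base point, satisfy a nontrivial polynomial relation. -/
theorem exists_relation_of_annihilates {k : Type} [Field k] {n : ℕ}
    (P : Ideal (MvPolynomial (Fin n) k)) [P.IsPrime]
    (I : Set (Fin n)) (s : MvPolynomial (Fin n) k) (a : I → Fin n → MvPolynomial (Fin n) k)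
    (htr : Algebra.trdeg k (MvPolynomial (Fin n) k ⧸ P) = Cardinal.mk I)
    (hdiag : ∀ i, a i i - s ∈ P) (hoff : ∀ i k : I, k ≠ i → a i k ∈ P) (j : Fin n) :
    ∃ H : Polynomial (MvPolynomial (Fin n) k), H ≠ 0 ∧
      ∀ l z : Fin n → k, (∀ h ∈ P, eval z h = 0) → eval z s ≠ 0 →
        (∀ i, ∑ r, l r * eval z (a i r) = 0) →
        (H.map (eval l)).eval (z j) = 0 := by
  classical
  let A := MvPolynomial (Fin n) k ⧸ P
  let J : Type := {r : Fin n // r ∉ I}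
  let B := MvPolynomial J A
  let mk : MvPolynomial (Fin n) k →ₐ[k] A := Ideal.Quotient.mkₐ k P
  let L : Fin n → B := fun r => if h : r ∈ I then
      -∑ t : J, X t * C (mk (a ⟨r, h⟩ t)) else X ⟨r, h⟩ * C (mk s)
  let y : Option (Fin n) → B := fun o => o.elim (C (mk (X j))) L
  have hdep : ¬ AlgebraicIndependent k y := by
    intro h
    have h1 := h.cardinalMk_le_trdeg
    rw [← trdeg_add_eq k A (A := B), htr, MvPolynomial.trdeg_of_isDomain (ι := J)] at h1
    simp only [Cardinal.mk_fintype, Fintype.card_option, Fintype.card_fin,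
      Cardinal.lift_natCast] at h1
    have h2 : Fintype.card I + Fintype.card J = n := by
      have := Fintype.card_subtype_compl (fun r => r ∈ I)
      have h3 := Fintype.card_subtype_le (fun r => r ∈ I)
      simp only [Fintype.card_fin] at this h3
      have h4 : Fintype.card I = Fintype.card {r // r ∈ I} := by congr
      have h5 : Fintype.card J = Fintype.card {r // r ∉ I} := by congr
      omega
    have h3 : n + 1 ≤ Fintype.card I + Fintype.card J := by exact_mod_cast h1
    omega
  rw [algebraicIndependent_iff] at hdep
  push Not at hdep
  obtain ⟨p, hp0, hp⟩ := hdep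
  refine ⟨optionEquivLeft k (Fin n) p, by simpa using hp, ?_⟩
  intro l z hz hs hl
  let ev : A →ₐ[k] k := Ideal.Quotient.liftₐ P (aeval z) (by simpa [aeval_eq_eval] using hz)
  have hev : ∀ q, ev (mk q) = eval z q := fun q => by
    rw [← aeval_eq_eval]
    exact Ideal.Quotient.liftₐ_apply P (aeval z) _ _
  let φ : B →ₐ[k] k := aevalTower ev (fun t : J => l t / eval z s)
  have hφX : ∀ t, φ (X t) = l t / eval z s := aevalTower_X _ _
  have hφC : ∀ q, φ (C q) = ev q := aevalTower_C _ _
  have hφ : ∀ o, φ (y o) = Option.elim o (z j) l := by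
    rintro (_ | r)
    · simp [y, hev, hφC]
    · by_cases h : r ∈ I
      · have h1 := hl ⟨r, h⟩
        rw [← Fintype.sum_subtype_add_sum_subtype (fun r => r ∈ I),
          Finset.sum_eq_single ⟨r, h⟩ ?_ (by simp)] at h1
        · have h2 : eval z (a ⟨r, h⟩ r) = eval z s := by
            simpa [sub_eq_zero] using hz _ (hdiag ⟨r, h⟩)
          simp only [h2] at h1
          simp only [y, L, h, dite_true, Option.elim_some, map_neg, map_sum, map_mul, hφX, hφC, hev]
          rw [neg_eq_iff_add_eq_zero, ← mul_right_inj' hs, mul_add, Finset.mul_sum, mul_zero, ← h1,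
            add_comm, mul_comm]
          congr 1
          refine Finset.sum_congr rfl fun t _ => ?_
          field_simp
        · intro t _ ht
          rw [hz _ (hoff ⟨r, h⟩ t ht), mul_zero]
      · simp [y, L, h, hev, hs, hφX, hφC]
  rw [← optionEquivLeft_elim_eval, ← funext hφ, ← aeval_eq_eval]
  exact (comp_aeval_apply y φ p).symm.trans (by rw [hp0, map_zero])

theorem hasDerivAt_eval_comp {σ : Type*} [Fintype σ] {γ : ℝ → σ → ℝ} {v : σ → ℝ} {u : ℝ}
    (hγ : HasDerivAt γ v u) (p : MvPolynomial σ ℝ) :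
    HasDerivAt (fun u => eval (γ u) p) (∑ j, v j * eval (γ u) (pderiv j p)) u := by
  classical
  induction p using MvPolynomial.induction_on with
  | C r => simpa using hasDerivAt_const u r
  | add p q hp hq => simpa [mul_add, Finset.sum_add_distrib] using hp.fun_add hq
  | mul_X p l hp =>
    have h := hp.fun_mul (hasDerivAt_pi.1 hγ l)
    simp only [map_mul, eval_X]
    refine h.congr_deriv ?_
    have e : ∀ j, v j * eval (γ u) (pderiv j (p * X l)) =
        v j * eval (γ u) (pderiv j p) * γ u l + if j = l then eval (γ u) p * v j else 0 := by
      intro j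
      by_cases hj : j = l
      · subst hj
        simp [pderiv_X]
        ring
      · simp [pderiv_X, hj, Ne.symm hj]
        ring
    simp only [e, Finset.sum_add_distrib, Finset.sum_mul]
    simp

/-- Forward invariance of an algebraic set under the flow of a tangent vector field. -/
theorem eval_eq_zero_of_integralCurve {n : ℕ} (P : Ideal (MvPolynomial (Fin n) ℝ))
    (a : Fin n → MvPolynomial (Fin n) ℝ) (ha : ∀ h ∈ P, ∑ j, a j * pderiv j h ∈ P)
    (γ : ℝ → Fin n → ℝ) (δ : ℝ)
    (hγ : ∀ u ∈ Icc 0 δ, HasDerivAt γ (fun j => eval (γ u) (a j)) u)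
    (h0 : ∀ h ∈ P, eval (γ 0) h = 0) : ∀ u ∈ Icc 0 δ, ∀ h ∈ P, eval (γ u) h = 0 := by
  obtain ⟨k, g, hg⟩ := Submodule.fg_iff_exists_fin_generating_family.1
    (IsNoetherian.noetherian P : P.FG)
  have hgP : ∀ i, g i ∈ P := fun i => by
    rw [← hg]; exact Submodule.subset_span (mem_range_self i)
  have hspan : ∀ h ∈ P, ∃ c : Fin k → MvPolynomial (Fin n) ℝ, ∑ i, c i * g i = h := by
    intro h hh
    rw [← hg] at hh
    exact (Submodule.mem_span_range_iff_exists_fun _).1 hh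
  choose b hb using fun i => hspan _ (ha (g i) (hgP i))
  have hγc : ContinuousOn γ (Icc 0 δ) := fun u hu => (hγ u hu).continuousAt.continuousWithinAt
  let F : ℝ → Fin k → ℝ := fun u i => eval (γ u) (g i)
  let F' : ℝ → Fin k → ℝ := fun u i => ∑ j, eval (γ u) (b i j) * F u j
  have hF : ∀ u ∈ Icc 0 δ, HasDerivAt F (F' u) u := by
    intro u hu
    refine hasDerivAt_pi.2 fun i => (hasDerivAt_eval_comp (hγ u hu) (g i)).congr_deriv ?_
    have := congrArg (eval (γ u)) (hb i)
    simpa [F', F] using this.symm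
  have hcont : ContinuousOn (fun u => ∑ i, ∑ j, |eval (γ u) (b i j)|) (Icc 0 δ) := by
    refine continuousOn_finsetSum _ fun i _ => continuousOn_finsetSum _ fun j _ => ?_
    exact ((MvPolynomial.continuous_eval (b i j)).comp_continuousOn hγc).abs
  obtain ⟨M, hM⟩ := isCompact_Icc.bddAbove_image hcont
  have hzero : ∀ u ∈ Icc 0 δ, F u = 0 := by
    refine eq_zero_of_abs_deriv_le_mul_abs_self_of_eq_zero_right (K := M)
      (fun u hu => (hF u hu).continuousAt.continuousWithinAt)
      (fun u hu => (hF u (Ico_subset_Icc_self hu)).hasDerivWithinAt)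
      (funext fun i => h0 _ (hgP i)) fun u hu => ?_
    have hMu : ∑ i, ∑ j, |eval (γ u) (b i j)| ≤ M :=
      hM (mem_image_of_mem _ (Ico_subset_Icc_self hu))
    have hM0 : 0 ≤ M := le_trans (by positivity) hMu
    refine (pi_norm_le_iff_of_nonneg (by positivity)).2 fun i => ?_
    calc ‖F' u i‖ ≤ ∑ j, |eval (γ u) (b i j)| * ‖F u‖ := by
          refine (norm_sum_le _ _).trans (Finset.sum_le_sum fun j _ => ?_)
          rw [norm_mul, Real.norm_eq_abs]
          gcongr
          exact norm_le_pi_norm (F u) j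
      _ = (∑ j, |eval (γ u) (b i j)|) * ‖F u‖ := by rw [Finset.sum_mul]
      _ ≤ M * ‖F u‖ := by
          gcongr
          exact (Finset.single_le_sum (f := fun i => ∑ j, |eval (γ u) (b i j)|)
            (fun _ _ => by positivity) (Finset.mem_univ i)).trans hMu
  intro u hu h hh
  obtain ⟨c, rfl⟩ := hspan h hh
  have := hzero u hu
  simp only [map_sum, map_mul]
  exact Finset.sum_eq_zero fun i _ => by
    rw [show eval (γ u) (g i) = 0 from congrFun this i, mul_zero]

theorem exists_integralCurve_mem_zeroLocus {n : ℕ} (P : Ideal (MvPolynomial (Fin n) ℝ))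
    (a : Fin n → MvPolynomial (Fin n) ℝ) (ha : ∀ h ∈ P, ∑ j, a j * pderiv j h ∈ P)
    (z : Fin n → ℝ) (hz : ∀ h ∈ P, eval z h = 0) :
    ∃ (γ : ℝ → Fin n → ℝ) (δ : ℝ), 0 < δ ∧ γ 0 = z ∧ ∀ u ∈ Ioo (-δ) δ,
      HasDerivAt γ (fun j => eval (γ u) (a j)) u ∧ ∀ h ∈ P, eval (γ u) h = 0 := by
  have hsmooth : ContDiffAt ℝ 1 (fun x : Fin n → ℝ => fun j => eval x (a j)) z := by
    refine contDiffAt_pi.2 fun j => ?_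
    exact (AnalyticOnNhd.eval_mvPolynomial (a j) z (mem_univ z)).contDiffAt
  obtain ⟨γ, h0, δ, hδ, hγ⟩ :=
    hsmooth.exists_forall_mem_closedBall_exists_eq_forall_mem_Ioo_hasDerivAt₀ 0
  simp only [zero_sub, zero_add] at hγ
  refine ⟨γ, δ, hδ, h0, fun u hu => ⟨hγ u hu, ?_⟩⟩
  rcases le_total 0 u with hu0 | hu0
  · exact eval_eq_zero_of_integralCurve P a ha γ u
      (fun w hw => hγ w ⟨by linarith [hw.1], hw.2.trans_lt hu.2⟩) (by rwa [h0]) u ⟨hu0, le_rfl⟩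
  · have h := eval_eq_zero_of_integralCurve P (fun j => -a j)
      (fun h hh => by simpa using P.neg_mem (ha h hh)) (fun w => γ (-w)) (-u)
      (fun w hw => by
        have h1 := hγ (-w) ⟨by linarith [hw.2, hu.1], by linarith [hw.1]⟩
        have h2 := h1.scomp w (hasDerivAt_neg w)
        refine h2.congr_deriv ?_
        ext j
        simp)
      (by simpa [h0] using hz) (-u) ⟨by linarith, le_rfl⟩
    simpa using h

/-- `z` is a critical point of the linear form `l` on the real zero set of `J`: the form has
vanishing derivative along every curve in the zero set through `z`. -/
def IsCriticalPoint {n : ℕ} (J : Ideal (MvPolynomial (Fin n) ℝ)) (l z : Fin n → ℝ) : Prop :=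
  (∀ h ∈ J, eval z h = 0) ∧ ∀ (γ : ℝ → Fin n → ℝ) (v : Fin n → ℝ) (δ : ℝ), 0 < δ → γ 0 = z →
    HasDerivAt γ v 0 → ContinuousOn γ (Ioo (-δ) δ) →
    (∀ u ∈ Ioo (-δ) δ, ∀ h ∈ J, eval (γ u) h = 0) → ∑ j, l j * v j = 0

theorem IsCriticalPoint.mono {n : ℕ} {J J' : Ideal (MvPolynomial (Fin n) ℝ)} {l z : Fin n → ℝ}
    (hz : IsCriticalPoint J l z) (hJ : J ≤ J') (hz' : ∀ h ∈ J', eval z h = 0) :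
    IsCriticalPoint J' l z :=
  ⟨hz', fun γ v δ hδ h0 hv hc hγ => hz.2 γ v δ hδ h0 hv hc fun u hu h hh => hγ u hu h (hJ hh)⟩

theorem IsCriticalPoint.sup_span_singleton {n : ℕ} {J : Ideal (MvPolynomial (Fin n) ℝ)}
    {l z : Fin n → ℝ} (hz : IsCriticalPoint J l z) {s : MvPolynomial (Fin n) ℝ}
    (hs : eval z s = 0) : IsCriticalPoint (J ⊔ Ideal.span {s}) l z := by
  refine hz.mono le_sup_left fun h hh => ?_
  have : J ⊔ Ideal.span {s} ≤ RingHom.ker (eval z) :=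
    sup_le hz.1 ((Ideal.span_singleton_le_iff_mem _).2 hs)
  exact this hh

/-- A generic linear form has finitely many critical points on a real algebraic set. -/
theorem exists_forall_finite_isCriticalPoint {n : ℕ} (J : Ideal (MvPolynomial (Fin n) ℝ)) :
    ∃ Q : MvPolynomial (Fin n) ℝ, Q ≠ 0 ∧
      ∀ l, eval l Q ≠ 0 → {z | IsCriticalPoint J l z}.Finite := by
  induction J using WellFoundedGT.induction with
  | ind J ih =>
  have hlt : ∀ s, s ∉ J → J < J ⊔ Ideal.span {s} := fun s hs =>
    left_lt_sup.2 fun h => hs (h (Ideal.mem_span_singleton_self s))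
  by_cases hJ : J.IsPrime
  · obtain ⟨I, s, a, htr, hs, ha, hdiag, hoff⟩ := exists_tangent_vectorFields J
    choose H hH0 hH using exists_relation_of_annihilates J I s a htr hdiag hoff
    obtain ⟨Q, hQ0, hQ⟩ := ih _ (hlt s hs)
    refine ⟨Q * ∏ j, (H j).leadingCoeff, mul_ne_zero hQ0 (Finset.prod_ne_zero_iff.2
      fun j _ => Polynomial.leadingCoeff_ne_zero.2 (hH0 j)), fun l hl => ?_⟩
    rw [map_mul, map_prod] at hl
    have hl' : ∀ j, (H j).map (eval l) ≠ 0 := fun j h => by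
      refine Finset.prod_ne_zero_iff.1 (right_ne_zero_of_mul hl) j (Finset.mem_univ j) ?_
      rw [Polynomial.leadingCoeff, ← Polynomial.coeff_map, h, Polynomial.coeff_zero]
    refine ((hQ l (left_ne_zero_of_mul hl)).union
      (Set.Finite.pi' fun j => Polynomial.finite_setOfPred_isRoot (hl' j))).subset fun z hz => ?_
    by_cases hsz : eval z s = 0
    · exact Or.inl (hz.sup_span_singleton hsz)
    · refine Or.inr fun j => hH j l z hz.1 hsz fun i => ?_
      obtain ⟨γ, δ, hδ, h0, hγ⟩ := exists_integralCurve_mem_zeroLocus J (a i) (ha i) z hz.1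
      have := hz.2 γ _ δ hδ h0 (hγ 0 ⟨by linarith, hδ⟩).1
        (fun u hu => (hγ u hu).1.continuousAt.continuousWithinAt) fun u hu => (hγ u hu).2
      rwa [h0] at this
  · rw [Ideal.isPrime_iff] at hJ
    by_cases htop : J = ⊤
    · refine ⟨1, one_ne_zero, fun l _ => ?_⟩
      convert Set.finite_empty
      refine Set.eq_empty_of_forall_notMem fun z hz => ?_
      simpa using hz.1 1 (by simp [htop])
    · push Not at hJ
      obtain ⟨x, y, hxy, hx, hy⟩ := hJ htop
      obtain ⟨Q, hQ0, hQ⟩ := ih _ (hlt x hx)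
      obtain ⟨Q', hQ0', hQ'⟩ := ih _ (hlt y hy)
      refine ⟨Q * Q', mul_ne_zero hQ0 hQ0', fun l hl => ?_⟩
      rw [map_mul] at hl
      refine ((hQ l (left_ne_zero_of_mul hl)).union
        (hQ' l (right_ne_zero_of_mul hl))).subset fun z hz => ?_
      have h := hz.1 _ hxy
      rw [map_mul, mul_eq_zero] at h
      exact h.imp hz.sup_span_singleton hz.sup_span_singleton

/-- `det M` times the row of `adj M` with index `i`; for invertible `M` it is proportional to the
linear form reading off the coordinate `i` in the basis given by the columns of `M`. -/
def adjugateForm {n : ℕ} {A : Type*} [CommRing A] (i : Fin n) (M : Matrix (Fin n) (Fin n) A) :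
    Fin n → A :=
  fun j => M.det * M.adjugate i j

theorem map_adjugateForm {n : ℕ} {A B : Type*} [CommRing A] [CommRing B] (φ : A →+* B) (i : Fin n)
    (M : Matrix (Fin n) (Fin n) A) (j : Fin n) :
    φ (adjugateForm i M j) = adjugateForm i (φ.mapMatrix M) j := by
  simp only [adjugateForm, map_mul, RingHom.map_det, ← RingHom.map_adjugate]
  rfl

theorem adjugateForm_of_det_ne_zero {n : ℕ} (i : Fin n) (M : Matrix (Fin n) (Fin n) ℝ)
    (hM : M.det ≠ 0) (j : Fin n) : adjugateForm i M j = M.det ^ 2 * M⁻¹ i j := by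
  simp only [adjugateForm, Matrix.inv_def, Ring.inverse_eq_inv', Matrix.smul_apply, smul_eq_mul]
  field_simp

theorem exists_adjugateForm_eq {n : ℕ} (i : Fin n) (l : Fin n → ℝ) (hl : l i ≠ 0) :
    ∃ M : Matrix (Fin n) (Fin n) ℝ, M.det ≠ 0 ∧ adjugateForm i M = l := by
  let N : Matrix (Fin n) (Fin n) ℝ := (1 : Matrix (Fin n) (Fin n) ℝ).updateRow i ((l i ^ 2)⁻¹ • l)
  have hN : N.det = (l i)⁻¹ := by
    rw [← Matrix.cramer_transpose_apply]
    simp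
    field_simp
  have hN0 : N.det ≠ 0 := by rw [hN]; exact inv_ne_zero hl
  have hdet : N⁻¹.det = l i := by
    rw [Matrix.det_nonsing_inv, hN]
    simp
  refine ⟨N⁻¹, by rwa [hdet], funext fun j => ?_⟩
  rw [adjugateForm_of_det_ne_zero _ _ (by rwa [hdet]), Matrix.nonsing_inv_nonsing_inv _ hN0.isUnit,
    hdet]
  simp [N]
  field_simp

theorem exists_forall_finite_isCriticalPoint_adjugateForm {n m : ℕ} (i : Fin n)
    (f : Fin m → MvPolynomial (Fin n) ℝ) :
    ∃ Q : MvPolynomial (Fin n × Fin n) ℝ, Q ≠ 0 ∧ ∀ M : Matrix (Fin n) (Fin n) ℝ,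
      eval (fun ij => M ij.1 ij.2) Q ≠ 0 → M.det ≠ 0 ∧
        ∀ S : Set (Fin m),
          {z | IsCriticalPoint (Ideal.span (f '' S)) (adjugateForm i M) z}.Finite := by
  classical
  choose Q hQ0 hQ using fun S : Set (Fin m) => exists_forall_finite_isCriticalPoint
    (Ideal.span (f '' S))
  let G := Matrix.mvPolynomialX (Fin n) (Fin n) ℝ
  have hG : ∀ M : Matrix (Fin n) (Fin n) ℝ,
      (eval fun ij : Fin n × Fin n => M ij.1 ij.2).mapMatrix G = M := fun M =>
    Matrix.mvPolynomialX_mapMatrix_eval M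
  let P : MvPolynomial (Fin n × Fin n) ℝ := G.det * aeval (adjugateForm i G) (∏ S, Q S)
  have hP : ∀ M : Matrix (Fin n) (Fin n) ℝ, eval (fun ij => M ij.1 ij.2) P =
      M.det * ∏ S, eval (adjugateForm i M) (Q S) := by
    intro M
    have h1 : (fun j => eval (fun ij : Fin n × Fin n => M ij.1 ij.2) (adjugateForm i G j)) =
        adjugateForm i M := by
      funext j
      rw [map_adjugateForm, hG]
    have h2 : ∀ p : MvPolynomial (Fin n) ℝ, eval (fun ij : Fin n × Fin n => M ij.1 ij.2)
        (aeval (adjugateForm i G) p) = eval (adjugateForm i M) p := by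
      intro p
      rw [← h1, ← aeval_eq_eval, ← aeval_eq_eval]
      exact comp_aeval_apply _ (aeval _) p
    simp only [P, map_mul, h2, map_prod, RingHom.map_det, hG]
  refine ⟨P, fun h => ?_, fun M hM => ?_⟩
  · have h0 : X i * ∏ S, Q S ≠ 0 :=
      mul_ne_zero (X_ne_zero i) (Finset.prod_ne_zero_iff.2 fun S _ => hQ0 S)
    obtain ⟨l, hl⟩ : ∃ l, eval l (X i * ∏ S, Q S) ≠ 0 := by
      by_contra! h1
      exact h0 (MvPolynomial.funext fun l => by rw [h1, map_zero])
    rw [map_mul, eval_X, map_prod] at hl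
    obtain ⟨M, hM, hMl⟩ := exists_adjugateForm_eq i l (left_ne_zero_of_mul hl)
    have h2 := hP M
    rw [h, hMl, map_zero] at h2
    exact mul_ne_zero hM (right_ne_zero_of_mul hl) h2.symm
  · rw [hP] at hM
    exact ⟨left_ne_zero_of_mul hM, fun S => hQ S _
      (Finset.prod_ne_zero_iff.1 (right_ne_zero_of_mul hM) S (Finset.mem_univ S))⟩

theorem eval_compMat {n : ℕ} (V : Matrix (Fin n) (Fin n) ℚ) (p : MvPolynomial (Fin n) ℝ)
    (x : Fin n → ℝ) :
    eval x (compMat V p) = eval ((V.map (Rat.cast : ℚ → ℝ)).mulVec x) p := by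
  rw [compMat, ← aeval_eq_eval, ← aeval_eq_eval]
  rw [comp_aeval_apply]
  congr 2
  funext j
  simp [Matrix.mulVec, dotProduct]

theorem Sign3c.holds_zero (s : Sign3c) : s.holds 0 := by
  cases s <;> simp [Sign3c.holds]

theorem Sign3c.eventually_holds {s : Sign3c} {r : ℝ} (h : s.holds r) (hr : r ≠ 0) :
    ∀ᶠ r' in nhds r, s.holds r' := by
  cases s with
  | le => exact (eventually_lt_nhds (lt_of_le_of_ne h hr)).mono fun _ => le_of_lt
  | eq => exact absurd h hr
  | ge => exact (eventually_gt_nhds (lt_of_le_of_ne h hr.symm)).mono fun _ => le_of_lt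

/-- Extremal points of the coordinate `i` on a component of a basic closed semialgebraic set are
critical points of that coordinate on the zero set of the active constraints. -/
theorem isCriticalPoint_of_forall_mem_component_le {n m : ℕ} (i : Fin n)
    (f : Fin m → MvPolynomial (Fin n) ℝ) (σ : Fin m → Sign3c) (V : Matrix (Fin n) (Fin n) ℚ)
    {M : Matrix (Fin n) (Fin n) ℝ} (hMV : M = V.map (Rat.cast : ℚ → ℝ)) (hM : M.det ≠ 0)
    {R : Set (EuclideanSpace ℝ (Fin n))}
    (hR : R = {x | ∀ i, (σ i).holds (eval (fun j => x j) (compMat V (f i)))})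
    {x₀ z : EuclideanSpace ℝ (Fin n)} (hz : z ∈ connectedComponentIn R x₀) {e : ℝ} (he : e ≠ 0)
    (hmin : ∀ x ∈ connectedComponentIn R x₀, e * z i ≤ e * x i) :
    IsCriticalPoint (Ideal.span (f '' {k | eval (M.mulVec z) (f k) = 0})) (adjugateForm i M)
      (M.mulVec z) := by
  have hMu : IsUnit M.det := hM.isUnit
  have heval : ∀ (x : EuclideanSpace ℝ (Fin n)) k,
      eval (fun j => x j) (compMat V (f k)) = eval (M.mulVec x) (f k) := fun x k => by
    rw [eval_compMat, hMV]
  have hzR : z ∈ R := connectedComponentIn_subset _ _ hz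
  refine ⟨?_, fun γ v δ hδ h0 hv hc hγ => ?_⟩
  · have : Ideal.span (f '' {k | eval (M.mulVec z) (f k) = 0}) ≤
        RingHom.ker (eval (M.mulVec (z : Fin n → ℝ))) := by
      rw [Ideal.span_le]
      rintro _ ⟨k, hk, rfl⟩
      exact hk
    exact fun h hh => this hh
  · let β : ℝ → EuclideanSpace ℝ (Fin n) := fun u => WithLp.toLp 2 (M⁻¹.mulVec (γ u))
    have hβ : ∀ u, M.mulVec (β u) = γ u := fun u => by
      simp [β, Matrix.mulVec_mulVec, Matrix.mul_nonsing_inv _ hMu]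
    have hβ0 : β 0 = z := by
      simp [β, h0, Matrix.mulVec_mulVec, Matrix.nonsing_inv_mul _ hMu]
    have hβc : ContinuousOn β (Ioo (-δ) δ) := by
      refine (PiLp.continuous_toLp 2 _).comp_continuousOn ?_
      exact (Continuous.matrix_mulVec continuous_const continuous_id).comp_continuousOn hc
    have hmem : ∀ᶠ u in nhds (0 : ℝ), u ∈ Ioo (-δ) δ :=
      Ioo_mem_nhds (by linarith) hδ
    have hβR : ∀ᶠ u in nhds (0 : ℝ), β u ∈ R := by
      rw [hR]
      simp only [mem_ofPred_eq, heval, hβ]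
      refine Filter.eventually_all.2 fun k => ?_
      by_cases hk : eval (M.mulVec z) (f k) = 0
      · filter_upwards [hmem] with u hu
        rw [hγ u hu _ (Ideal.subset_span ⟨k, hk, rfl⟩)]
        exact Sign3c.holds_zero _
      · have h1 : (σ k).holds (eval (M.mulVec z) (f k)) := by
          rw [hR] at hzR
          rw [← heval]
          exact hzR k
        have h2 : Filter.Tendsto (fun u => eval (γ u) (f k)) (nhds 0)
            (nhds (eval (M.mulVec z) (f k))) := by
          have := ((MvPolynomial.continuous_eval (f k)).continuousAt (x := γ 0)).comp
            hv.continuousAt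
          rw [← h0]
          exact this
        exact h2.eventually (Sign3c.eventually_holds h1 hk)
    obtain ⟨δ', hδ', hball⟩ := Metric.eventually_nhds_iff_ball.1 (hmem.and hβR)
    have hconn : IsPreconnected (β '' Metric.ball 0 δ') := by
      refine IsPreconnected.image ?_ _ (hβc.mono fun u hu => (hball u hu).1)
      exact (convex_ball _ _).isPreconnected
    have hsub : β '' Metric.ball 0 δ' ⊆ connectedComponentIn R x₀ := by
      rw [connectedComponentIn_eq hz]
      refine hconn.subset_connectedComponentIn ⟨0, Metric.mem_ball_self hδ', hβ0⟩ ?_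
      rintro _ ⟨u, hu, rfl⟩
      exact (hball u hu).2
    have hlocal : IsLocalMin (fun u => e * β u i) 0 := by
      filter_upwards [Metric.ball_mem_nhds (0 : ℝ) hδ'] with u hu
      simp only [hβ0]
      exact hmin _ (hsub ⟨u, hu, rfl⟩)
    have hderiv : HasDerivAt (fun u => e * β u i) (e * ∑ j, M⁻¹ i j * v j) 0 := by
      refine HasDerivAt.const_mul e ?_
      change HasDerivAt (fun u => ∑ j, M⁻¹ i j * γ u j) _ _
      exact HasDerivAt.fun_sum fun j _ => (hasDerivAt_pi.1 hv j).const_mul _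
    have h1 := (mul_eq_zero.1 (hlocal.hasDerivAt_eq_zero hderiv)).resolve_left he
    simp only [adjugateForm_of_det_ne_zero i M hM, mul_assoc, ← Finset.mul_sum, h1, mul_zero]

theorem finite_setOf_minimal_component {n m : ℕ} (i : Fin n)
    (f : Fin m → MvPolynomial (Fin n) ℝ) (σ : Fin m → Sign3c) (V : Matrix (Fin n) (Fin n) ℚ)
    {M : Matrix (Fin n) (Fin n) ℝ} (hMV : M = V.map (Rat.cast : ℚ → ℝ)) (hM : M.det ≠ 0)
    (hfin : ∀ S : Set (Fin m),
      {z | IsCriticalPoint (Ideal.span (f '' S)) (adjugateForm i M) z}.Finite)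
    {R : Set (EuclideanSpace ℝ (Fin n))}
    (hR : R = {x | ∀ i, (σ i).holds (eval (fun j => x j) (compMat V (f i)))})
    (x₀ : EuclideanSpace ℝ (Fin n)) {e : ℝ} (he : e ≠ 0) :
    {z ∈ connectedComponentIn R x₀ |
      ∀ x ∈ connectedComponentIn R x₀, e * z i ≤ e * x i}.Finite := by
  have hinj : Function.Injective fun z : EuclideanSpace ℝ (Fin n) => M.mulVec (z : Fin n → ℝ) :=
    (Matrix.mulVec_injective_iff_isUnit.2 ((Matrix.isUnit_iff_isUnit_det M).2 hM.isUnit)).comp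
      (WithLp.ofLp_injective 2)
  refine ((Set.finite_iUnion hfin).preimage hinj.injOn).subset fun z hz => ?_
  exact mem_iUnion.2 ⟨_, isCriticalPoint_of_forall_mem_component_le i f σ V hMV hM hR hz.1 he hz.2⟩

/-- In a compact space, a closed set missing the component of `z` misses a clopen
neighbourhood of `z`. -/
theorem exists_isClopen_disjoint_of_disjoint_connectedComponent {X : Type*} [TopologicalSpace X]
    [T2Space X] [CompactSpace X] {z : X} {D : Set X} (hD : IsClosed D)
    (h : Disjoint (connectedComponent z) D) : ∃ U : Set X, IsClopen U ∧ z ∈ U ∧ Disjoint U D := by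
  refine hD.isCompact.induction_on (p := fun D => ∃ U : Set X, IsClopen U ∧ z ∈ U ∧ Disjoint U D)
    ⟨univ, isClopen_univ, mem_univ z, disjoint_empty _⟩ ?_ ?_ ?_
  · rintro s t hst ⟨U, hU, hzU, hUt⟩
    exact ⟨U, hU, hzU, hUt.mono_right hst⟩
  · rintro s t ⟨U, hU, hzU, hUs⟩ ⟨U', hU', hzU', hUt⟩
    exact ⟨U ∩ U', hU.inter hU', ⟨hzU, hzU'⟩, disjoint_union_right.2
      ⟨hUs.mono_left inter_subset_left, hUt.mono_left inter_subset_right⟩⟩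
  · intro x hx
    have hx' : x ∉ connectedComponent z := fun hxz => h.le_bot ⟨hxz, hx⟩
    rw [connectedComponent_eq_iInter_isClopen, mem_iInter] at hx'
    push Not at hx'
    obtain ⟨⟨U, hU, hzU⟩, hxU⟩ := hx'
    exact ⟨Uᶜ, mem_nhdsWithin_of_mem_nhds (hU.compl.isOpen.mem_nhds hxU), U, hU, hzU,
      disjoint_compl_right⟩

/-- An isolated minimiser of `φ` on a component of a closed set `R` has arbitrarily small
neighbourhoods on whose frontier `φ` is larger on all of `R`. -/
theorem exists_isOpen_frontier_lt {E : Type*} [MetricSpace E] [ProperSpace E] {R : Set E}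
    (hR : IsClosed R) {φ : E → ℝ} (hφ : Continuous φ) {z : E} (hz : z ∈ R)
    (hfin : {x ∈ connectedComponentIn R z | φ x ≤ φ z}.Finite) {ε : ℝ} (hε : 0 < ε) :
    ∃ O : Set E, IsOpen O ∧ z ∈ O ∧ O ⊆ Metric.ball z ε ∧
      ∀ x ∈ frontier O, x ∈ R → φ z < φ x := by
  obtain ⟨r, hr0, hrε, hr⟩ : ∃ r, 0 < r ∧ r < ε ∧ ∀ x ∈ connectedComponentIn R z, φ x ≤ φ z →
      dist x z = r → False := by
    obtain ⟨r, ⟨hr0, hrε⟩, hr⟩ := (Ioo_infinite hε).exists_notMem_finite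
      (hfin.image fun x => dist x z)
    exact ⟨r, hr0, hrε, fun x hx hx' hd => hr ⟨x, ⟨hx, hx'⟩, hd⟩⟩
  let Y : Set E := R ∩ Metric.closedBall z r
  have hY : IsCompact Y := (isCompact_closedBall z r).inter_left hR
  have : CompactSpace Y := isCompact_iff_compactSpace.1 hY
  let z' : Y := ⟨z, hz, Metric.mem_closedBall_self hr0.le⟩
  let D : Set Y := {x | dist (x : E) z = r ∧ φ x ≤ φ z}
  have hD : IsClosed D := (isClosed_eq (by fun_prop) continuous_const).inter
    (isClosed_le (hφ.comp continuous_subtype_val) continuous_const)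
  obtain ⟨U, hU, hzU, hUD⟩ := exists_isClopen_disjoint_of_disjoint_connectedComponent
    (z := z') hD <| by
      refine disjoint_left.2 fun x hx hxD => hr x ?_ hxD.2 hxD.1
      have h1 : IsPreconnected (Subtype.val '' connectedComponent z') :=
        isPreconnected_connectedComponent.image _ continuous_subtype_val.continuousOn
      refine h1.subset_connectedComponentIn ⟨z', mem_connectedComponent, rfl⟩ ?_ ⟨x, hx, rfl⟩
      rintro _ ⟨y, -, rfl⟩
      exact y.2.1
  obtain ⟨O, P, hO, hP, hUO, hUP, hOP⟩ := SeparatedNhds.of_isCompact_isCompact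
    (hU.isClosed.isCompact.image continuous_subtype_val)
    (hU.compl.isClosed.isCompact.image continuous_subtype_val)
    ((disjoint_image_iff Subtype.val_injective).2 disjoint_compl_right)
  refine ⟨O ∩ Metric.ball z r, hO.inter Metric.isOpen_ball,
    ⟨hUO ⟨z', hzU, rfl⟩, Metric.mem_ball_self hr0⟩,
    inter_subset_right.trans (Metric.ball_subset_ball hrε.le), fun x hx hxR => ?_⟩
  rw [(hO.inter Metric.isOpen_ball).frontier_eq] at hx
  by_contra! hlt
  have hxO : x ∈ closure O := closure_mono inter_subset_left hx.1
  have hxr : x ∈ Metric.closedBall z r :=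
    Metric.closure_ball_subset_closedBall (closure_mono inter_subset_right hx.1)
  by_cases hxU : (⟨x, hxR, hxr⟩ : Y) ∈ U
  · refine hUD.le_bot ⟨hxU, ?_, hlt⟩
    refine le_antisymm hxr (not_lt.1 fun h => hx.2 ⟨hUO ⟨_, hxU, rfl⟩, h⟩)
  · exact (hOP.closure_left hP).le_bot ⟨hxO, hUP ⟨_, hxU, rfl⟩⟩

/-- Persistence of an isolated minimiser of a component under enlargement of the set. -/
theorem exists_isLocalMinOn_deformation {E : Type*} [MetricSpace E] [ProperSpace E]
    {R : ℝ → Set E} (hR : IsClosed {p : ℝ × E | p.2 ∈ R p.1}) {φ : E → ℝ} (hφ : Continuous φ)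
    {z : E} (hz : ∀ t ∈ Ico (0 : ℝ) 1, z ∈ R t)
    (hfin : {x ∈ connectedComponentIn (R 0) z | φ x ≤ φ z}.Finite) {ε : ℝ} (hε : 0 < ε) :
    ∃ t w, 0 < t ∧ t < ε ∧ t < 1 ∧ dist w z < ε ∧ w ∈ R t ∧ IsLocalMinOn φ (R t) w := by
  have hRt : ∀ t, IsClosed (R t) := fun t => hR.preimage (Continuous.prodMk_right t)
  obtain ⟨O, hO, hzO, hOε, hfr⟩ :=
    exists_isOpen_frontier_lt (hRt 0) hφ (hz 0 ⟨le_rfl, one_pos⟩) hfin hε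
  have hOc : IsCompact (closure O) :=
    (Metric.isBounded_ball.subset hOε).isCompact_closure
  let K : Set (ℝ × E) := (Icc 0 1 ×ˢ frontier O) ∩ ({p | p.2 ∈ R p.1} ∩ {p | φ p.2 ≤ φ z})
  have hK : IsCompact K :=
    (isCompact_Icc.prod
      (hOc.of_isClosed_subset isClosed_frontier frontier_subset_closure)).inter_right
      (hR.inter (isClosed_le (hφ.comp continuous_snd) continuous_const))
  have hK0 : ∀ᶠ t in nhds (0 : ℝ), t ∉ Prod.fst '' K := by
    refine (hK.image continuous_fst).isClosed.isOpen_compl.mem_nhds ?_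
    rintro ⟨⟨t, x⟩, ⟨hx, hxR, hxφ⟩, rfl⟩
    exact (hfr x hx.2 hxR).not_ge hxφ
  obtain ⟨t, htK, ht0, htε⟩ := ((hK0.filter_mono nhdsWithin_le_nhds).and
    (Ioo_mem_nhdsGT (show (0 : ℝ) < min ε 1 from lt_min hε one_pos))).exists
  have ht1 : t < 1 := htε.trans_le (min_le_right _ _)
  have hzt := hz t ⟨ht0.le, ht1⟩
  obtain ⟨w, ⟨hwR, hwO⟩, hw⟩ := (hOc.inter_left (hRt t)).exists_isMinOn
    ⟨z, hzt, subset_closure hzO⟩ hφ.continuousOn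
  have hwz : φ w ≤ φ z := hw ⟨hzt, subset_closure hzO⟩
  have hwO' : w ∈ O := by
    by_contra h
    exact htK ⟨(t, w), ⟨⟨⟨ht0.le, ht1.le⟩, by rw [hO.frontier_eq]; exact ⟨hwO, h⟩⟩, hwR, hwz⟩, rfl⟩
  refine ⟨t, w, ht0, htε.trans_le (min_le_left _ _), ht1, hOε hwO', hwR, ?_⟩
  filter_upwards [mem_nhdsWithin_of_mem_nhds (hO.mem_nhds hwO'), self_mem_nhdsWithin] with x hxO hxR
  exact hw ⟨hxR, subset_closure hxO⟩

theorem LinearIndependent.exists_dotProduct_eq {ι κ : Type*} [Fintype ι] [Fintype κ]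
    {a : ι → κ → ℝ} (ha : LinearIndependent ℝ a) (c : ι → ℝ) :
    ∃ v : κ → ℝ, ∀ i, ∑ k, a i k * v k = c i := by
  classical
  have h1 := LinearIndependent.rank_matrix (M := Matrix.of a) ha
  have h2 : LinearMap.range (Matrix.of a).mulVecLin = ⊤ :=
    Submodule.eq_top_of_finrank_eq (h1.trans (by simp))
  obtain ⟨v, hv⟩ := LinearMap.range_eq_top.1 h2 c
  exact ⟨v, congrFun hv⟩

/-- At a minimum of a coordinate subject to polynomial inequalities, the gradients of the active
constraints in the remaining coordinates are linearly dependent. -/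
theorem not_linearIndependent_of_eventually_le {n : ℕ} {ι : Type*} [Fintype ι] (i : Fin n)
    (p : ι → MvPolynomial (Fin n) ℝ) (s : ι → ℝ) (hs : ∀ k, s k ≠ 0) {e : ℝ} (he : e ≠ 0)
    (w : EuclideanSpace ℝ (Fin n)) (hp : ∀ k, eval (fun j => w j) (p k) = 0)
    (hw : ∀ᶠ x : EuclideanSpace ℝ (Fin n) in nhds w,
      (∀ k, 0 < s k * eval (fun j => x j) (p k)) → e * w i ≤ e * x i) :
    ¬ LinearIndependent ℝ (fun k => fun j : {j : Fin n // j ≠ i} =>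
      eval (fun j => w j) (pderiv j.1 (p k))) := by
  intro hli
  obtain ⟨v', hv'⟩ := hli.exists_dotProduct_eq
    fun k => s k + e * eval (fun j => w j) (pderiv i (p k))
  let v : Fin n → ℝ := fun j => if h : j = i then -e else v' ⟨j, h⟩
  have hvi : v i = -e := by simp [v]
  have hv : ∀ k, ∑ j, v j * eval (fun j => w j) (pderiv j (p k)) = s k := by
    intro k
    rw [← Fintype.sum_subtype_add_sum_subtype (fun j => j ≠ i)]
    have h1 : ∀ j : {j // j ≠ i}, v j * eval (fun j => w j) (pderiv j.1 (p k)) =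
        eval (fun j => w j) (pderiv j.1 (p k)) * v' j := fun j => by
      simp [v, j.2, mul_comm]
    rw [Finset.sum_congr rfl fun j _ => h1 j, hv' k]
    have : Unique {j // ¬ j ≠ i} := ⟨⟨⟨i, by simp⟩⟩, fun j => Subtype.ext (not_not.1 j.2)⟩
    rw [Fintype.sum_unique]
    have h2 : ((default : {j // ¬ j ≠ i}) : Fin n) = i := not_not.1 (default : {j // ¬ j ≠ i}).2
    rw [h2, hvi]
    ring
  let γ : ℝ → Fin n → ℝ := fun u j => w j + u * v j
  have hγ : HasDerivAt γ v 0 := hasDerivAt_pi.2 fun j => by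
    simpa only [one_mul] using ((hasDerivAt_id' (0 : ℝ)).mul_const (v j)).const_add (w j)
  have hγ0 : γ 0 = fun j => w j := by simp [γ]
  have hpos : ∀ᶠ u in nhdsWithin (0 : ℝ) (Ioi 0), ∀ k, 0 < s k * eval (γ u) (p k) := by
    refine Filter.eventually_all.2 fun k => ?_
    have h1 := ((hasDerivAt_eval_comp hγ (p k)).const_mul (s k)).tendsto_slope_zero_right
    rw [hγ0, hv] at h1
    filter_upwards [h1.eventually (eventually_gt_nhds (mul_self_pos.2 (hs k))),
      self_mem_nhdsWithin] with u hu hu0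
    simp only [zero_add, hp, mul_zero, sub_zero, smul_eq_mul] at hu
    exact (pos_iff_pos_of_mul_pos hu).1 (inv_pos.2 hu0)
  have htend : Filter.Tendsto (fun u => (WithLp.toLp 2 (γ u) : EuclideanSpace ℝ (Fin n)))
      (nhdsWithin 0 (Ioi 0)) (nhds w) := by
    have h1 := ((PiLp.continuous_toLp 2 _).continuousAt (x := γ 0)).comp hγ.continuousAt
    have h2 : (WithLp.toLp 2 (γ 0) : EuclideanSpace ℝ (Fin n)) = w := by rw [hγ0]
    have h3 : Filter.Tendsto (fun u => (WithLp.toLp 2 (γ u) : EuclideanSpace ℝ (Fin n)))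
      (nhds 0) (nhds (WithLp.toLp 2 (γ 0))) := h1
    rw [h2] at h3
    exact h3.mono_left nhdsWithin_le_nhds
  obtain ⟨u, hu, hu', hu0⟩ := ((htend.eventually hw).and
    (hpos.and self_mem_nhdsWithin)).exists
  have h1 := hu hu'
  simp only [γ, hvi] at h1
  nlinarith [mul_pos (mem_Ioi.1 hu0) (mul_self_pos.2 he)]

theorem neg_one_le_eval_chebyshev_T_of_even {d : ℕ} (hd : Even d) (y : ℝ) :
    -1 ≤ (Polynomial.Chebyshev.T ℝ d).eval y := by
  obtain ⟨k, rfl⟩ := hd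
  have h := congrArg (Polynomial.eval y) (Polynomial.Chebyshev.T_mul_T ℝ k k)
  simp only [sub_self, Polynomial.Chebyshev.T_zero, Polynomial.eval_mul, Polynomial.eval_add,
    Polynomial.eval_one, Polynomial.eval_ofNat] at h
  push_cast
  nlinarith [mul_self_nonneg ((Polynomial.Chebyshev.T ℝ k).eval y)]

theorem eval_gpPoly_pos {n d q : ℕ} (hd : Even d) (hq : n < q) (x : Fin n → ℝ) :
    0 < eval x (gpPoly n d q) := by
  have h : ∀ k : Fin n, (-1 : ℝ) ≤ eval x (C (((q - n - 1 + ((k : ℕ) + 1) : ℕ) : ℝ))⁻¹ *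
      Polynomial.aeval (X k) (Polynomial.Chebyshev.T ℝ d)) := by
    intro k
    have h1 : eval x (Polynomial.aeval (X k) (Polynomial.Chebyshev.T ℝ d)) =
        (Polynomial.Chebyshev.T ℝ d).eval (x k) := by
      rw [← aeval_eq_eval]
      rw [← Polynomial.aeval_algHom_apply, aeval_X, Polynomial.coe_aeval_eq_eval]
    rw [map_mul, eval_C, h1]
    have h2 : (((q - n - 1 + ((k : ℕ) + 1) : ℕ) : ℝ))⁻¹ ≤ 1 :=
      inv_le_one_of_one_le₀ (by exact_mod_cast (by omega))
    have h3 : 0 ≤ (((q - n - 1 + ((k : ℕ) + 1) : ℕ) : ℝ))⁻¹ := by positivity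
    nlinarith [neg_one_le_eval_chebyshev_T_of_even hd (x k)]
  have hsum := Finset.sum_le_sum fun k (_ : k ∈ Finset.univ) => h k
  have hq0 : (0 : ℝ) < (q : ℝ)⁻¹ := inv_pos.2 (by exact_mod_cast (by omega))
  rw [gpPoly, map_add, map_add, eval_C, eval_C, map_sum]
  simp only [Finset.sum_const, Finset.card_univ, Fintype.card_fin, nsmul_eq_mul] at hsum
  linarith

theorem eval_Fdef {n d q : ℕ} (V : Matrix (Fin n) (Fin n) ℚ) (p : MvPolynomial (Fin n) ℝ)
    (b : Bool) (t : ℝ) (x : Fin n → ℝ) :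
    eval x (Fdef d q V p b t) = (1 - t) * eval x (compMat V p) +
      t * if b then eval x (gpPoly n d q) else -eval x (gpPoly n d q) := by
  cases b <;> simp [Fdef]

theorem continuous_eval_ofLp {n : ℕ} (p : MvPolynomial (Fin n) ℝ) :
    Continuous fun x : EuclideanSpace ℝ (Fin n) => eval (fun j => x j) p :=
  (MvPolynomial.continuous_eval p).comp (PiLp.continuous_ofLp 2 _)

/-- The deformed semialgebraic set at parameter `t`: equations are thickened to the region between
the zero sets of `F̃⁺` and `F̃⁻`. -/
def deformedSet {n m : ℕ} (f : Fin m → MvPolynomial (Fin n) ℝ) (d : ℕ) (q : Fin m → ℕ)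
    (σ : Fin m → Sign3c) (V : Matrix (Fin n) (Fin n) ℚ) (t : ℝ) :
    Set (EuclideanSpace ℝ (Fin n)) :=
  {x | ∀ i, (σ i ≠ .le → 0 ≤ eval (fun j => x j) (Fdef d (q i) V (f i) true t)) ∧
    (σ i ≠ .ge → eval (fun j => x j) (Fdef d (q i) V (f i) false t) ≤ 0)}

theorem isClosed_deformedSet {n m : ℕ} (f : Fin m → MvPolynomial (Fin n) ℝ) (d : ℕ)
    (q : Fin m → ℕ) (σ : Fin m → Sign3c) (V : Matrix (Fin n) (Fin n) ℚ) :
    IsClosed {p : ℝ × EuclideanSpace ℝ (Fin n) | p.2 ∈ deformedSet f d q σ V p.1} := by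
  have hc : ∀ p : MvPolynomial (Fin n) ℝ,
      Continuous fun y : ℝ × EuclideanSpace ℝ (Fin n) => eval (fun j => y.2 j) p :=
    fun p => (continuous_eval_ofLp p).comp continuous_snd
  have hF : ∀ i b, Continuous fun y : ℝ × EuclideanSpace ℝ (Fin n) =>
      eval (fun j => y.2 j) (Fdef d (q i) V (f i) b y.1) := by
    intro i b
    have h1 := hc (compMat V (f i))
    have h2 := hc (gpPoly n d (q i))
    simp only [eval_Fdef]
    cases b <;> simp only [Bool.false_eq_true, if_true, if_false] <;> fun_prop
  simp only [deformedSet, mem_ofPred_eq]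
  simp only [ofPred_forall, ofPred_and]
  exact isClosed_iInter fun i =>
    (isClosed_iInter fun _ => isClosed_le continuous_const (hF i true)).inter
      (isClosed_iInter fun _ => isClosed_le (hF i false) continuous_const)

theorem deformedSet_zero {n m : ℕ} (f : Fin m → MvPolynomial (Fin n) ℝ) (d : ℕ)
    (q : Fin m → ℕ) (σ : Fin m → Sign3c) (V : Matrix (Fin n) (Fin n) ℚ) :
    deformedSet f d q σ V 0 =
      {x | ∀ i, (σ i).holds (eval (fun j => x j) (compMat V (f i)))} := by
  ext x
  refine forall_congr' fun i => ?_
  simp only [eval_Fdef]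
  cases σ i <;> simp [Sign3c.holds, le_antisymm_iff, and_comm]

theorem deformedSet_zero_subset {n m : ℕ} (f : Fin m → MvPolynomial (Fin n) ℝ) {d : ℕ}
    (hd : Even d) {q : Fin m → ℕ} (hq : ∀ i, n < q i) (σ : Fin m → Sign3c)
    (V : Matrix (Fin n) (Fin n) ℚ) {t : ℝ} (ht : t ∈ Ico (0 : ℝ) 1) :
    deformedSet f d q σ V 0 ⊆ deformedSet f d q σ V t := by
  intro x hx i
  have hg := mul_nonneg ht.1 (eval_gpPoly_pos hd (hq i) fun j => x j).le
  have ht' : 0 ≤ 1 - t := sub_nonneg.2 ht.2.le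
  obtain ⟨h1, h2⟩ := hx i
  simp only [eval_Fdef, sub_zero, one_mul, zero_mul, add_zero, Bool.false_eq_true, if_true,
    if_false] at h1 h2 ⊢
  exact ⟨fun h => by nlinarith [mul_nonneg ht' (h1 h)],
    fun h => by nlinarith [mul_nonneg ht' (neg_nonneg.2 (h2 h))]⟩

/-- A local minimum of a coordinate on a deformed set lies on some of the hypersurfaces
`F̃ᵢ^± = 0`, where the projection forgetting that coordinate degenerates. -/
theorem exists_active_of_isLocalMinOn_deformedSet {n m : ℕ} (i₀ : Fin n)
    (f : Fin m → MvPolynomial (Fin n) ℝ) {d : ℕ} (hd : Even d) {q : Fin m → ℕ}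
    (hq : ∀ i, n < q i) (σ : Fin m → Sign3c) (V : Matrix (Fin n) (Fin n) ℚ) {t : ℝ} (ht : 0 < t)
    {e : ℝ} (he : e ≠ 0) {w : EuclideanSpace ℝ (Fin n)} (hw : w ∈ deformedSet f d q σ V t)
    (hmin : IsLocalMinOn (fun x : EuclideanSpace ℝ (Fin n) => e * x i₀)
      (deformedSet f d q σ V t) w) :
    ∃ (S : Finset (Fin m)) (τ : Fin m → Bool),
      (∀ i ∈ S, σ i = .ge → τ i = true) ∧ (∀ i ∈ S, σ i = .le → τ i = false) ∧
      (∀ i ∈ S, eval (fun j => w j) (Fdef d (q i) V (f i) (τ i) t) = 0) ∧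
      ¬ LinearIndependent ℝ (fun i : S => fun k : {k : Fin n // k ≠ i₀} =>
        eval (fun j => w j) (pderiv k.1 (Fdef d (q i.1) V (f i.1) (τ i.1) t))) := by
  classical
  let F : Fin m → Bool → EuclideanSpace ℝ (Fin n) → ℝ := fun i b x =>
    eval (fun j => x j) (Fdef d (q i) V (f i) b t)
  have hFc : ∀ i b, Continuous (F i b) := fun i b => continuous_eval_ofLp _
  have hFlt : ∀ i x, F i false x < F i true x := by
    intro i x
    have := mul_pos ht (eval_gpPoly_pos hd (hq i) fun j => x j)
    simp only [F, eval_Fdef, Bool.false_eq_true, if_true, if_false]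
    linarith
  let τ : Fin m → Bool := fun i => decide (σ i ≠ .le ∧ F i true w = 0)
  let S : Finset (Fin m) := Finset.univ.filter fun i =>
    (σ i ≠ .le ∧ F i true w = 0) ∨ (σ i ≠ .ge ∧ F i false w = 0)
  have hτ : ∀ i ∈ S, F i (τ i) w = 0 ∧ (σ i = .ge → τ i = true) ∧ (σ i = .le → τ i = false) := by
    intro i hi
    by_cases h : σ i ≠ .le ∧ F i true w = 0
    · have h1 : τ i = true := decide_eq_true h
      exact ⟨h1 ▸ h.2, fun _ => h1, fun h2 => absurd h2 h.1⟩
    · have h1 : τ i = false := decide_eq_false h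
      have h2 := ((Finset.mem_filter.1 hi).2).resolve_left h
      exact ⟨h1 ▸ h2.2, fun h3 => absurd h3 h2.1, fun _ => h1⟩
  refine ⟨S, τ, fun i hi => (hτ i hi).2.1, fun i hi => (hτ i hi).2.2, fun i hi => (hτ i hi).1, ?_⟩
  refine not_linearIndependent_of_eventually_le i₀ (fun i : S => Fdef d (q i.1) V (f i.1) (τ i.1) t)
    (fun i => if τ i then 1 else -1) (fun i => by split_ifs <;> norm_num) he w
    (fun i => (hτ i.1 i.2).1) ?_
  have hnear : ∀ᶠ x in nhds w, ∀ i, (F i true w > 0 → F i true x > 0) ∧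
      (F i false w < 0 → F i false x < 0) := by
    refine Filter.eventually_all.2 fun i => Filter.Eventually.and ?_ ?_
    · by_cases h : F i true w > 0
      · filter_upwards [(hFc i true).continuousAt.eventually (eventually_gt_nhds h)] with x hx _
        exact hx
      · exact Filter.Eventually.of_forall fun x hx => absurd hx h
    · by_cases h : F i false w < 0
      · filter_upwards [(hFc i false).continuousAt.eventually (eventually_lt_nhds h)] with x hx _
        exact hx
      · exact Filter.Eventually.of_forall fun x hx => absurd hx h
  filter_upwards [hnear, eventually_nhdsWithin_iff.1 hmin] with x hx hxmin hpos
  refine hxmin fun i => ⟨fun hi => ?_, fun hi => ?_⟩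
  · rcases ((hw i).1 hi).lt_or_eq with h | h
    · exact ((hx i).1 h).le
    · have hact : σ i ≠ .le ∧ F i true w = 0 := ⟨hi, h.symm⟩
      have h1 : τ i = true := decide_eq_true hact
      have h2 := hpos ⟨i, Finset.mem_filter.2 ⟨Finset.mem_univ i, Or.inl hact⟩⟩
      simp only [h1, if_true, one_mul] at h2
      exact h2.le
  · rcases ((hw i).2 hi).lt_or_eq with h | h
    · exact ((hx i).2 h).le
    · have h1 : τ i = false := decide_eq_false fun h' => by
        have := hFlt i w
        rw [h'.2] at this
        exact this.ne h
      have h2 := hpos ⟨i, Finset.mem_filter.2 ⟨Finset.mem_univ i, Or.inr ⟨hi, h⟩⟩⟩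
      simp only [h1, Bool.false_eq_true, if_false] at h2
      linarith

theorem IsClosed.connectedComponentIn {X : Type*} [TopologicalSpace X] {R : Set X}
    (hR : IsClosed R) (x : X) : IsClosed (connectedComponentIn R x) := by
  by_cases hx : x ∈ R
  · refine isClosed_of_closure_subset ?_
    exact isPreconnected_connectedComponentIn.closure.subset_connectedComponentIn
      (subset_closure (mem_connectedComponentIn hx))
      (closure_minimal (connectedComponentIn_subset R x) hR)
  · rw [connectedComponentIn_eq_empty hx]
    exact isClosed_empty

theorem exists_sign_of_mem_ZZ {n : ℕ} {hn : 0 < n} {A : Set (EuclideanSpace ℝ (Fin n))}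
    {z : EuclideanSpace ℝ (Fin n)} (hz : z ∈ ZZ hn A) :
    z ∈ closure A ∧ ∃ e : ℝ, e ≠ 0 ∧ ∀ x ∈ A, e * z ⟨0, hn⟩ ≤ e * x ⟨0, hn⟩ := by
  rcases hz with ⟨hzA, hb, hz⟩ | ⟨hzA, hb, hz⟩
  · refine ⟨hzA, 1, one_ne_zero, fun x hx => ?_⟩
    rw [hz, one_mul, one_mul]
    exact csInf_le hb ⟨x, hx, rfl⟩
  · refine ⟨hzA, -1, by norm_num, fun x hx => ?_⟩
    rw [hz, neg_one_mul, neg_one_mul, neg_le_neg_iff]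
    exact le_csSup hb ⟨x, hx, rfl⟩

theorem statement10 (n m : ℕ) (hn : 0 < n) (f : Fin m → MvPolynomial (Fin n) ℝ)
    (d : ℕ) (hd0 : 0 < d) (hdeven : Even d) (hdeg : ∀ i, (f i).totalDegree ≤ d)
    (q : Fin m → ℕ) (hqmono : StrictMono q)
    (hqprime : ∀ i, (q i).Prime) (hqn : ∀ i, n < q i)
    (hqsmall : ∀ i : Fin m, ∀ p : ℕ, p.Prime → n < p → p < q i → ∃ j : Fin m, q j = p)
    (σ : Fin m → Sign3c) :
    ∃ Q : MvPolynomial (Fin n × Fin n) ℝ, Q ≠ 0 ∧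
      ∀ V : Matrix (Fin n) (Fin n) ℚ,
        eval (fun ij => ((V ij.1 ij.2 : ℚ) : ℝ)) Q ≠ 0 →
          IsUnit V ∧
          ∀ R : Set (EuclideanSpace ℝ (Fin n)),
            R = {x | ∀ i, (σ i).holds (eval (fun j => x j) (compMat V (f i)))} →
            ∀ x₀ ∈ R, ∀ z ∈ ZZ hn (connectedComponentIn R x₀), ∀ ε : ℝ, 0 < ε →
              ∃ S : Finset (Fin m), S.Nonempty ∧ S.card ≤ n ∧
                ∃ τ : Fin m → Bool,
                  (∀ i ∈ S, σ i = Sign3c.ge → τ i = true) ∧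
                  (∀ i ∈ S, σ i = Sign3c.le → τ i = false) ∧
                  ∃ t : ℝ, 0 < t ∧ t < ε ∧
                    ∃ w : EuclideanSpace ℝ (Fin n), dist w z < ε ∧
                      (∀ i ∈ S, eval (fun j => w j) (Fdef d (q i) V (f i) (τ i) t) = 0) ∧
                      (S.card ≤ n - 1 →
                        ¬ LinearIndependent ℝ
                          (fun i : S => fun k : {k : Fin n // k ≠ ⟨0, hn⟩} =>
                            eval (fun j => w j)
                              (pderiv k.1 (Fdef d (q i.1) V (f i.1) (τ i.1) t)))) := by
  obtain ⟨Q, hQ0, hQ⟩ := exists_forall_finite_isCriticalPoint_adjugateForm ⟨0, hn⟩ f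
  refine ⟨Q, hQ0, fun V hV => ?_⟩
  obtain ⟨hdet, hfin⟩ := hQ (V.map (Rat.cast : ℚ → ℝ)) hV
  refine ⟨?_, fun R hR x₀ hx₀ z hz ε hε => ?_⟩
  · rw [Matrix.isUnit_iff_isUnit_det, isUnit_iff_ne_zero]
    intro h
    refine hdet ?_
    have := (Rat.castHom ℝ).map_det V
    rw [h, map_zero] at this
    exact this.symm
  have hR0 : R = deformedSet f d q σ V 0 := by rw [hR, deformedSet_zero]
  have hclosed := isClosed_deformedSet f d q σ V
  have hRclosed : IsClosed R := by
    rw [hR0]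
    exact hclosed.preimage (Continuous.prodMk_right 0)
  obtain ⟨hzC, e, he, hmin⟩ := exists_sign_of_mem_ZZ hz
  rw [(hRclosed.connectedComponentIn x₀).closure_eq] at hzC
  have hzR : z ∈ R := connectedComponentIn_subset _ _ hzC
  have hfinite := finite_setOf_minimal_component ⟨0, hn⟩ f σ V rfl hdet hfin hR x₀ he
  have hcoord : Continuous fun x : EuclideanSpace ℝ (Fin n) => e * x ⟨0, hn⟩ := by fun_prop
  obtain ⟨t, w, ht0, htε, -, hwz, hwR, hw⟩ := exists_isLocalMinOn_deformation hclosed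
    hcoord (z := z) (fun t ht => deformedSet_zero_subset f hdeven hqn σ V ht (hR0 ▸ hzR))
    (by
      rw [← hR0, ← connectedComponentIn_eq hzC]
      exact hfinite.subset fun x hx => ⟨hx.1, fun y hy => hx.2.trans (hmin y hy)⟩) hε
  obtain ⟨S, τ, hge, hle, hzero, hdep⟩ :=
    exists_active_of_isLocalMinOn_deformedSet ⟨0, hn⟩ f hdeven hqn σ V ht0 he hwR hw
  by_cases hcard : S.card ≤ n
  · refine ⟨S, ?_, hcard, τ, hge, hle, t, ht0, htε, w, hwz, hzero, fun _ => hdep⟩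
    refine Finset.nonempty_iff_ne_empty.2 ?_
    rintro rfl
    exact hdep linearIndependent_empty_type
  · obtain ⟨S', hS', hcard'⟩ := Finset.exists_subset_card_eq (not_le.1 hcard).le
    exact ⟨S', Finset.card_pos.1 (by omega), hcard'.le, τ, fun i hi => hge i (hS' hi),
      fun i hi => hle i (hS' hi), t, ht0, htε, w, hwz, fun i hi => hzero i (hS' hi),
      fun h => by omega⟩
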